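/- Existence and uniqueness for the singular transition-path ODE started on the boundary (the Remark following the proof of Theorem 1, equation (2.42)): Let a: ℝ^d → ℝ^{d×d} be C¹ with symmetric positive-definite values, b: ℝ^d → ℝ^d be C¹, and q: ℝ^d → ℝ be C² on a neighborhood of y₀ with q(y₀) = 0 and ⟨∇q(y₀), a(y₀)∇q(y₀)⟩ > 0. Define K(y) = b(y) + 2 a(y)∇q(y)/q(y) wherever q(y) > 0. Then for all sufficiently small T > 0 there exists exactly one continuous function Ȳ: [0,T] → ℝ^d such that Ȳ(0) = y₀, q(Ȳ(t)) > 0 for all t ∈ (0,T], the map s ↦ K(Ȳ(s)) is integrable on (0,T], and Ȳ(t) = y₀ + ∫₀ᵗ K(Ȳ(s)) ds for all t ∈ [0,T]. -/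

import Mathlib

open scoped BigOperators
open Set MeasureTheory

/-- Partial derivative `∂ᵢ u (x)` on `ℝ^d = (Fin d → ℝ)`. -/
noncomputable def pd {d : ℕ} (i : Fin d) (u : (Fin d → ℝ) → ℝ) (x : Fin d → ℝ) : ℝ :=
  fderiv ℝ u x (Pi.single i 1)

/-- The drift `K(y) = b(y) + 2 a(y)∇q(y) / q(y)` of the transition path process
(its `i`-th component). -/
noncomputable def Kdrift {d : ℕ} (a : (Fin d → ℝ) → Fin d → Fin d → ℝ)
    (b : (Fin d → ℝ) → Fin d → ℝ) (q : (Fin d → ℝ) → ℝ)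
    (y : Fin d → ℝ) : Fin d → ℝ :=
  fun i => b y i + 2 * (∑ j, a y i j * pd j q y) / q y

/-- `Y` is a solution on `[0, T]` of the singular transition-path integral
equation `Y(t) = y₀ + ∫₀ᵗ K(Y(s)) ds` with `q ∘ Y > 0` on `(0, T]`. -/
def IsTPSolution {d : ℕ} (a : (Fin d → ℝ) → Fin d → Fin d → ℝ)
    (b : (Fin d → ℝ) → Fin d → ℝ) (q : (Fin d → ℝ) → ℝ)
    (y₀ : Fin d → ℝ) (T : ℝ) (Y : ℝ → Fin d → ℝ) : Prop :=
  ContinuousOn Y (Set.Icc 0 T) ∧ Y 0 = y₀ ∧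
    (∀ t ∈ Set.Ioc (0 : ℝ) T, 0 < q (Y t)) ∧
    MeasureTheory.IntegrableOn (fun s => Kdrift a b q (Y s)) (Set.Ioc (0 : ℝ) T) ∧
    ∀ t ∈ Set.Icc (0 : ℝ) T, Y t = y₀ + ∫ s in (0 : ℝ)..t, Kdrift a b q (Y s)

/-- A strictly monotone continuous function on `[a, b]` has a continuous right inverse on
`[τ a, τ b]`. -/
lemma exists_continuous_rightInverse_of_strictMonoOn {τ : ℝ → ℝ} {a b : ℝ} (hab : a ≤ b)
    (hτ : ContinuousOn τ (Icc a b)) (hm : StrictMonoOn τ (Icc a b)) :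
    ∃ σ : ℝ → ℝ, Continuous σ ∧ ∀ t ∈ Icc (τ a) (τ b), σ t ∈ Icc a b ∧ τ (σ t) = t := by
  have ha : a ∈ Icc a b := left_mem_Icc.2 hab
  have hb : b ∈ Icc a b := right_mem_Icc.2 hab
  have hτab : τ a ≤ τ b := hm.monotoneOn ha hb hab
  let f : Icc a b → Icc (τ a) (τ b) := fun x =>
    ⟨τ x, hm.monotoneOn ha x.2 x.2.1, hm.monotoneOn x.2 hb x.2.2⟩
  have hf : StrictMono f := fun x y hxy => hm x.2 y.2 hxy
  have hsurj : Function.Surjective f := by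
    rintro ⟨t, ht⟩
    obtain ⟨x, hx, rfl⟩ := intermediate_value_Icc hab hτ ht
    exact ⟨⟨x, hx⟩, rfl⟩
  let e := hf.orderIsoOfSurjective f hsurj
  refine ⟨IccExtend hτab fun t => (e.symm t : ℝ),
    (continuous_subtype_val.comp e.symm.continuous).Icc_extend', fun t ht => ?_⟩
  rw [IccExtend_of_mem _ _ ht]
  exact ⟨(e.symm ⟨t, ht⟩).2, congrArg Subtype.val (e.apply_symm_apply ⟨t, ht⟩)⟩

/-- The primitive of an integrable function which is continuous on the open interval `(0, T)` is
continuous on `[0, T]` and differentiable on `(0, T)`. -/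
lemma continuousOn_and_hasDerivAt_primitive {E : Type*} [NormedAddCommGroup E] [NormedSpace ℝ E]
    [CompleteSpace E] {f : ℝ → E} {T : ℝ} (hT : 0 ≤ T) (hf : ContinuousOn f (Ioo 0 T))
    (hint : IntegrableOn f (Ioc 0 T)) :
    ContinuousOn (fun t => ∫ s in (0 : ℝ)..t, f s) (Icc 0 T) ∧
      ∀ t ∈ Ioo 0 T, HasDerivAt (fun t => ∫ s in (0 : ℝ)..t, f s) (f t) t := by
  refine ⟨?_, fun t ht => ?_⟩
  · have := intervalIntegral.continuousOn_primitive_interval (a := 0) (b := T) (f := f)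
      (μ := volume) (by rwa [uIcc_of_le hT, integrableOn_Icc_iff_integrableOn_Ioc])
    rwa [uIcc_of_le hT] at this
  · refine intervalIntegral.integral_hasDerivAt_right ?_
      (hf.stronglyMeasurableAtFilter isOpen_Ioo t ht) (hf.continuousAt (isOpen_Ioo.mem_nhds ht))
    rw [intervalIntegrable_iff_integrableOn_Ioc_of_le ht.1.le]
    exact hint.mono_set (Ioc_subset_Ioc_right ht.2.le)

/-- Uniqueness for `y' = w(t) G(y)` with `G` Lipschitz and `w ≥ 0` having a continuous primitive;
the weight `w` may blow up at the endpoints. -/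
lemma eqOn_of_hasDerivAt_smul_lipschitzOnWith {d : ℕ} {G : (Fin d → ℝ) → Fin d → ℝ}
    {S : Set (Fin d → ℝ)} {L : NNReal} (hG : LipschitzOnWith L G S) {T : ℝ} {s w : ℝ → ℝ}
    (hs : ContinuousOn s (Icc 0 T)) (hs' : ∀ t ∈ Ioo 0 T, HasDerivAt s (w t) t)
    (hw : ∀ t ∈ Ioo 0 T, 0 ≤ w t) {Y W : ℝ → Fin d → ℝ}
    (hY : ContinuousOn Y (Icc 0 T)) (hY' : ∀ t ∈ Ioo 0 T, HasDerivAt Y (w t • G (Y t)) t)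
    (hYS : ∀ t ∈ Ioo 0 T, Y t ∈ S)
    (hW : ContinuousOn W (Icc 0 T)) (hW' : ∀ t ∈ Ioo 0 T, HasDerivAt W (w t • G (W t)) t)
    (hWS : ∀ t ∈ Ioo 0 T, W t ∈ S) (h0 : Y 0 = W 0) : EqOn Y W (Icc 0 T) := by
  set e : ℝ → ℝ := fun t => ∑ i, (Y t i - W t i) ^ 2 with he
  set C : ℝ := 2 * d * L with hC
  have hderiv : ∀ t ∈ Ioo 0 T, HasDerivAt (fun t => e t * Real.exp (-(C * s t)))
      ((∑ i, 2 * (Y t i - W t i) * (w t * (G (Y t) i - G (W t) i))) * Real.exp (-(C * s t)) +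
        e t * (Real.exp (-(C * s t)) * -(C * w t))) t := by
    intro t ht
    refine HasDerivAt.mul ?_ (((hs' t ht).const_mul C).neg.exp)
    refine HasDerivAt.fun_sum fun i _ => ?_
    have := (((hasDerivAt_pi.1 (hY' t ht)) i).sub ((hasDerivAt_pi.1 (hW' t ht)) i)).pow 2
    refine this.congr_deriv ?_
    simp only [Nat.cast_ofNat, Pi.sub_apply, Pi.smul_apply, smul_eq_mul, Nat.add_one_sub_one,
      pow_one]
    ring
  have hanti : AntitoneOn (fun t => e t * Real.exp (-(C * s t))) (Icc 0 T) := by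
    refine antitoneOn_of_deriv_nonpos (convex_Icc 0 T) ?_ ?_ ?_
    · refine ContinuousOn.mul ?_ (Real.continuous_exp.comp_continuousOn
        (continuousOn_const.mul hs).neg)
      exact continuousOn_finsetSum _ fun i _ =>
        ((continuousOn_pi.1 hY i).sub (continuousOn_pi.1 hW i)).pow 2
    · rw [interior_Icc]
      exact fun t ht => (hderiv t ht).differentiableAt.differentiableWithinAt
    · rw [interior_Icc]
      intro t ht
      rw [(hderiv t ht).deriv]
      have hexp := Real.exp_pos (-(C * s t))
      suffices h : ∑ i, 2 * (Y t i - W t i) * (w t * (G (Y t) i - G (W t) i)) ≤ C * w t * e t by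
        nlinarith
      have hterm : ∀ i, 2 * (Y t i - W t i) * (w t * (G (Y t) i - G (W t) i)) ≤
          2 * L * w t * e t := by
        intro i
        have hcoord : ∀ j, |Y t j - W t j| ≤ √(e t) := fun j =>
          Real.abs_le_sqrt (Finset.single_le_sum (f := fun i => (Y t i - W t i) ^ 2)
            (fun i _ => sq_nonneg _) (Finset.mem_univ j))
        have hnorm : ‖Y t - W t‖ ≤ √(e t) :=
          (pi_norm_le_iff_of_nonneg (Real.sqrt_nonneg _)).2 hcoord
        have hGi : |G (Y t) i - G (W t) i| ≤ L * √(e t) := by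
          calc |G (Y t) i - G (W t) i| ≤ ‖G (Y t) - G (W t)‖ := norm_le_pi_norm (G (Y t) - G (W t)) i
            _ ≤ L * ‖Y t - W t‖ := hG.norm_sub_le (hYS t ht) (hWS t ht)
            _ ≤ L * √(e t) := by gcongr
        have he0 : 0 ≤ e t := Finset.sum_nonneg fun i _ => sq_nonneg _
        calc 2 * (Y t i - W t i) * (w t * (G (Y t) i - G (W t) i))
            = 2 * w t * ((Y t i - W t i) * (G (Y t) i - G (W t) i)) := by ring
          _ ≤ 2 * w t * (√(e t) * (L * √(e t))) := by
              have := hw t ht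
              refine mul_le_mul_of_nonneg_left ?_ (by positivity)
              refine (le_abs_self _).trans ?_
              rw [abs_mul]
              exact mul_le_mul (hcoord i) hGi (abs_nonneg _) (Real.sqrt_nonneg _)
          _ = 2 * L * w t * (√(e t) * √(e t)) := by ring
          _ = 2 * L * w t * e t := by rw [Real.mul_self_sqrt he0]
      calc _ ≤ ∑ _i : Fin d, 2 * L * w t * e t := Finset.sum_le_sum fun i _ => hterm i
        _ = C * w t * e t := by simp [hC]; ring
  intro t ht
  have h := hanti (left_mem_Icc.2 (ht.1.trans ht.2)) ht ht.1
  have he00 : e 0 = 0 := by simp [he, h0]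
  simp only [he00, zero_mul] at h
  have het : e t ≤ 0 := nonpos_of_mul_nonpos_left h (Real.exp_pos _)
  funext i
  have hi : (Y t i - W t i) ^ 2 ≤ e t :=
    Finset.single_le_sum (f := fun i => (Y t i - W t i) ^ 2)
      (fun i _ => sq_nonneg _) (Finset.mem_univ i)
  exact sub_eq_zero.1 (pow_eq_zero_iff two_ne_zero |>.1 (le_antisymm (hi.trans het) (sq_nonneg _)))

/-- Regularity of the data of the singular field `b + q⁻¹ V` on a set `S`. -/
structure IsRegularOn {d : ℕ} (V b : (Fin d → ℝ) → Fin d → ℝ) (q : (Fin d → ℝ) → ℝ)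
    (S : Set (Fin d → ℝ)) : Prop where
  continuousOn_V : ContinuousOn V S
  continuousOn_b : ContinuousOn b S
  continuousOn_q : ContinuousOn q S
  norm_V_ge : ∃ c > 0, ∀ y ∈ S, c ≤ ‖V y‖
  lipschitz : ∃ L, LipschitzOnWith L (fun y => q y • b y + V y) S

/-- A trajectory `Z` on `[0, ε]` of the regular field `q b + V`, with `q > 0` on `(0, ε]`, together
with the primitive `τ` of `q ∘ Z` (the physical time along the trajectory). -/
structure IsRegularTrajectory {d : ℕ} (V b : (Fin d → ℝ) → Fin d → ℝ) (q : (Fin d → ℝ) → ℝ)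
    (S : Set (Fin d → ℝ)) (ε : ℝ) (Z : ℝ → Fin d → ℝ) (τ : ℝ → ℝ) : Prop where
  pos : 0 < ε
  continuousOn : ContinuousOn Z (Icc 0 ε)
  hasDerivAt : ∀ s ∈ Ioo 0 ε, HasDerivAt Z (q (Z s) • b (Z s) + V (Z s)) s
  mem : ∀ s ∈ Icc 0 ε, Z s ∈ S
  q_pos : ∀ s ∈ Ioc 0 ε, 0 < q (Z s)
  continuousOn_time : ContinuousOn τ (Icc 0 ε)
  hasDerivAt_time : ∀ s ∈ Ioo 0 ε, HasDerivAt τ (q (Z s)) s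
  time_zero : τ 0 = 0

lemma IsRegularTrajectory.strictMonoOn_time {d : ℕ} {V b : (Fin d → ℝ) → Fin d → ℝ}
    {q : (Fin d → ℝ) → ℝ} {S : Set (Fin d → ℝ)} {ε : ℝ} {Z : ℝ → Fin d → ℝ} {τ : ℝ → ℝ}
    (h : IsRegularTrajectory V b q S ε Z τ) : StrictMonoOn τ (Icc 0 ε) := by
  refine strictMonoOn_of_deriv_pos (convex_Icc 0 ε) h.continuousOn_time fun s hs => ?_
  rw [interior_Icc] at hs
  rw [(h.hasDerivAt_time s hs).deriv]
  exact h.q_pos s ⟨hs.1, hs.2.le⟩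

/-- Along a solution of the singular equation staying in `S`, the function `1 / q` is integrable, and
the solution satisfies the regular equation in the time variable `s = ∫ 1 / q`. -/
lemma IsRegularOn.exists_timeChange {d : ℕ} {V b : (Fin d → ℝ) → Fin d → ℝ}
    {q : (Fin d → ℝ) → ℝ} {S : Set (Fin d → ℝ)} (h : IsRegularOn V b q S) {T : ℝ} (hT : 0 ≤ T)
    {y₀ : Fin d → ℝ} {Y : ℝ → Fin d → ℝ} (hY : ContinuousOn Y (Icc 0 T))
    (hYS : ∀ t ∈ Icc 0 T, Y t ∈ S) (hqY : ∀ t ∈ Ioc 0 T, 0 < q (Y t))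
    (hint : IntegrableOn (fun t => b (Y t) + (q (Y t))⁻¹ • V (Y t)) (Ioc 0 T))
    (heq : ∀ t ∈ Icc 0 T, Y t = y₀ + ∫ r in (0 : ℝ)..t, (b (Y r) + (q (Y r))⁻¹ • V (Y r))) :
    ∃ s : ℝ → ℝ, ContinuousOn s (Icc 0 T) ∧ s 0 = 0 ∧
      (∀ t ∈ Ioo 0 T, HasDerivAt s (q (Y t))⁻¹ t) ∧
      ∀ t ∈ Ioo 0 T, HasDerivAt Y ((q (Y t))⁻¹ • (q (Y t) • b (Y t) + V (Y t))) t := by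
  obtain ⟨c, hc, hVc⟩ := h.norm_V_ge
  have hbY : ContinuousOn (fun t => b (Y t)) (Icc 0 T) := h.continuousOn_b.comp hY hYS
  have hVY : ContinuousOn (fun t => V (Y t)) (Icc 0 T) := h.continuousOn_V.comp hY hYS
  have hqYc : ContinuousOn (fun t => (q (Y t))⁻¹) (Ioc 0 T) :=
    ((h.continuousOn_q.comp hY hYS).mono Ioc_subset_Icc_self).inv₀ fun t ht => (hqY t ht).ne'
  have hbint : IntegrableOn (fun t => b (Y t)) (Ioc 0 T) :=
    (hbY.integrableOn_compact isCompact_Icc).mono_set Ioc_subset_Icc_self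
  have hinv : IntegrableOn (fun t => (q (Y t))⁻¹) (Ioc 0 T) := by
    refine ((hint.sub hbint).norm.const_mul c⁻¹).mono'
      (hqYc.aestronglyMeasurable measurableSet_Ioc) ?_
    filter_upwards [ae_restrict_mem measurableSet_Ioc] with t ht
    have hq := inv_pos.2 (hqY t ht)
    rw [Pi.sub_apply, add_sub_cancel_left, norm_smul, Real.norm_of_nonneg hq.le,
      ← div_eq_inv_mul, le_div_iff₀ hc]
    exact mul_le_mul_of_nonneg_left (hVc _ (hYS t (Ioc_subset_Icc_self ht))) hq.le
  obtain ⟨hs, hs'⟩ := continuousOn_and_hasDerivAt_primitive hT (hqYc.mono Ioo_subset_Ioc_self) hinv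
  obtain ⟨-, hK'⟩ := continuousOn_and_hasDerivAt_primitive hT
    ((hbY.mono Ioo_subset_Icc_self).add
      ((hqYc.mono Ioo_subset_Ioc_self).smul (hVY.mono Ioo_subset_Icc_self))) hint
  refine ⟨_, hs, by simp, hs', fun t ht => ?_⟩
  have hne : q (Y t) ≠ 0 := (hqY t (Ioo_subset_Ioc_self ht)).ne'
  rw [smul_add, smul_smul, inv_mul_cancel₀ hne, one_smul]
  refine ((hK' t ht).const_add y₀).congr_of_eventuallyEq ?_
  filter_upwards [Ioo_mem_nhds ht.1 ht.2] with r hr using heq r (Ioo_subset_Icc_self hr)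

/-- A solution of the regular equation in the time variable `s`, as long as `s ≤ ε`, is the
reparametrization by `s` of the regular trajectory, and `s` is the inverse of `τ`. -/
lemma IsRegularTrajectory.eq_comp_timeChange {d : ℕ} {V b : (Fin d → ℝ) → Fin d → ℝ}
    {q : (Fin d → ℝ) → ℝ} {S : Set (Fin d → ℝ)} {ε : ℝ} {Z : ℝ → Fin d → ℝ} {τ : ℝ → ℝ}
    (hZ : IsRegularTrajectory V b q S ε Z τ) (h : IsRegularOn V b q S) {T : ℝ}
    {Y : ℝ → Fin d → ℝ} (hY : ContinuousOn Y (Icc 0 T)) (hY0 : Y 0 = Z 0)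
    (hYS : ∀ t ∈ Icc 0 T, Y t ∈ S) (hqY : ∀ t ∈ Ioc 0 T, 0 < q (Y t))
    {s : ℝ → ℝ} (hs : ContinuousOn s (Icc 0 T)) (hs0 : s 0 = 0)
    (hs' : ∀ t ∈ Ioo 0 T, HasDerivAt s (q (Y t))⁻¹ t)
    (hY' : ∀ t ∈ Ioo 0 T, HasDerivAt Y ((q (Y t))⁻¹ • (q (Y t) • b (Y t) + V (Y t))) t)
    (hsT : s T ≤ ε) :
    ∀ t ∈ Icc 0 T, s t ∈ Icc 0 ε ∧ Y t = Z (s t) ∧ τ (s t) = t := by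
  have hmono : StrictMonoOn s (Icc 0 T) := by
    refine strictMonoOn_of_deriv_pos (convex_Icc 0 T) hs fun t ht => ?_
    rw [interior_Icc] at ht
    rw [(hs' t ht).deriv]
    exact inv_pos.2 (hqY t ⟨ht.1, ht.2.le⟩)
  have hmaps : ∀ t ∈ Icc 0 T, s t ∈ Icc 0 ε := fun t ht =>
    have hT := ht.1.trans ht.2
    ⟨hs0 ▸ hmono.monotoneOn (left_mem_Icc.2 hT) ht ht.1,
      (hmono.monotoneOn ht (right_mem_Icc.2 hT) ht.2).trans hsT⟩
  have hmaps' : ∀ t ∈ Ioo 0 T, s t ∈ Ioo 0 ε := fun t ht =>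
    have hT := (ht.1.trans ht.2).le
    ⟨hs0 ▸ hmono (left_mem_Icc.2 hT) (Ioo_subset_Icc_self ht) ht.1,
      (hmono (Ioo_subset_Icc_self ht) (right_mem_Icc.2 hT) ht.2).trans_le hsT⟩
  obtain ⟨L, hL⟩ := h.lipschitz
  have hYZ : EqOn Y (Z ∘ s) (Icc 0 T) :=
    eqOn_of_hasDerivAt_smul_lipschitzOnWith hL hs hs'
      (fun t ht => (inv_pos.2 (hqY t (Ioo_subset_Ioc_self ht))).le) hY hY'
      (fun t ht => hYS t (Ioo_subset_Icc_self ht)) (hZ.continuousOn.comp hs hmaps)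
      (fun t ht => (hZ.hasDerivAt _ (hmaps' t ht)).scomp t (hs' t ht))
      (fun t ht => hZ.mem _ (hmaps t (Ioo_subset_Icc_self ht))) (by simp [hs0, hY0])
  refine fun t ht => ⟨hmaps t ht, hYZ ht, ?_⟩
  have hsub : Icc 0 t ⊆ Icc 0 T := Icc_subset_Icc_right ht.2
  have hone := intervalIntegral.integral_eq_sub_of_hasDerivAt_of_le (f := τ ∘ s)
    (f' := fun _ => 1) ht.1 ((hZ.continuousOn_time.comp hs hmaps).mono hsub)
    (fun r hr => by
      have hr' : r ∈ Ioo 0 T := ⟨hr.1, hr.2.trans_le ht.2⟩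
      have := (hZ.hasDerivAt_time _ (hmaps' r hr')).comp r (hs' r hr')
      rwa [show Z (s r) = Y r from (hYZ (Ioo_subset_Icc_self hr')).symm,
        mul_inv_cancel₀ (hqY r (Ioo_subset_Ioc_self hr')).ne'] at this)
    intervalIntegrable_const
  simpa [hs0, hZ.time_zero] using hone.symm

/-- A solution of the singular equation staying in `S` on `[0, T]`, `T < τ ε`, runs along the regular
trajectory with clock `τ`. -/
lemma IsRegularTrajectory.exists_eq_of_mem {d : ℕ} {V b : (Fin d → ℝ) → Fin d → ℝ}
    {q : (Fin d → ℝ) → ℝ} {S : Set (Fin d → ℝ)} {ε : ℝ} {Z : ℝ → Fin d → ℝ} {τ : ℝ → ℝ}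
    (hZ : IsRegularTrajectory V b q S ε Z τ) (h : IsRegularOn V b q S) {T : ℝ} (hT : 0 ≤ T)
    (hTε : T < τ ε) {Y : ℝ → Fin d → ℝ} (hY : ContinuousOn Y (Icc 0 T)) (hY0 : Y 0 = Z 0)
    (hYS : ∀ t ∈ Icc 0 T, Y t ∈ S) (hqY : ∀ t ∈ Ioc 0 T, 0 < q (Y t))
    (hint : IntegrableOn (fun t => b (Y t) + (q (Y t))⁻¹ • V (Y t)) (Ioc 0 T))
    (heq : ∀ t ∈ Icc 0 T, Y t = Z 0 + ∫ r in (0 : ℝ)..t, (b (Y r) + (q (Y r))⁻¹ • V (Y r))) :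
    ∀ t ∈ Icc 0 T, ∃ s ∈ Icc 0 ε, Y t = Z s ∧ τ s = t := by
  obtain ⟨s, hs, hs0, hs', hY'⟩ := h.exists_timeChange hT hY hYS hqY hint heq
  have hsT : s T ≤ ε := by
    by_contra! hlt
    obtain ⟨r, hr, hrε⟩ := intermediate_value_Icc hT hs ⟨hs0.trans_le hZ.pos.le, hlt.le⟩
    have hsub : Icc 0 r ⊆ Icc 0 T := Icc_subset_Icc_right hr.2
    have := (hZ.eq_comp_timeChange h (hY.mono hsub) hY0 (fun t ht => hYS t (hsub ht))
      (fun t ht => hqY t ⟨ht.1, ht.2.trans hr.2⟩) (hs.mono hsub) hs0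
      (fun t ht => hs' t ⟨ht.1, ht.2.trans_le hr.2⟩)
      (fun t ht => hY' t ⟨ht.1, ht.2.trans_le hr.2⟩) hrε.le r (right_mem_Icc.2 hr.1)).2.2
    rw [hrε] at this
    linarith [hr.2]
  exact fun t ht => ⟨s t, hZ.eq_comp_timeChange h hY hY0 hYS hqY hs hs0 hs' hY' hsT t ht⟩

/-- A regular trajectory in the open ball confines the solutions of the singular equation: every
solution on `[0, T]`, `T < τ ε`, runs along it with clock `τ`. -/
lemma IsRegularTrajectory.exists_eq {d : ℕ} {V b : (Fin d → ℝ) → Fin d → ℝ}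
    {q : (Fin d → ℝ) → ℝ} {ρ ε : ℝ} {Z : ℝ → Fin d → ℝ} {τ : ℝ → ℝ} (hρ : 0 < ρ)
    (h : IsRegularOn V b q (Metric.closedBall (Z 0) ρ))
    (hZ : IsRegularTrajectory V b q (Metric.closedBall (Z 0) ρ) ε Z τ)
    (hZρ : ∀ s ∈ Icc 0 ε, dist (Z s) (Z 0) < ρ) {T : ℝ}
    (hTε : T < τ ε) {Y : ℝ → Fin d → ℝ} (hY : ContinuousOn Y (Icc 0 T)) (hY0 : Y 0 = Z 0)
    (hqY : ∀ t ∈ Ioc 0 T, 0 < q (Y t))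
    (hint : IntegrableOn (fun t => b (Y t) + (q (Y t))⁻¹ • V (Y t)) (Ioc 0 T))
    (heq : ∀ t ∈ Icc 0 T, Y t = Z 0 + ∫ r in (0 : ℝ)..t, (b (Y r) + (q (Y r))⁻¹ • V (Y r))) :
    ∀ t ∈ Icc 0 T, ∃ s ∈ Icc 0 ε, Y t = Z s ∧ τ s = t := by
  have key : ∀ r ∈ Icc 0 T, (∀ t ∈ Icc 0 r, Y t ∈ Metric.closedBall (Z 0) ρ) →
      ∀ t ∈ Icc 0 r, ∃ s ∈ Icc 0 ε, Y t = Z s ∧ τ s = t := fun r hr hYr =>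
    hZ.exists_eq_of_mem h hr.1 (hr.2.trans_lt hTε) (hY.mono (Icc_subset_Icc_right hr.2)) hY0 hYr
      (fun t ht => hqY t ⟨ht.1, ht.2.trans hr.2⟩) (hint.mono_set (Ioc_subset_Ioc_right hr.2))
      (fun t ht => heq t ⟨ht.1, ht.2.trans hr.2⟩)
  suffices hball : ∀ t ∈ Icc 0 T, dist (Y t) (Z 0) < ρ from fun t ht =>
    key T (right_mem_Icc.2 (ht.1.trans ht.2)) (fun r hr => (hball r hr).le) t ht
  by_contra! hexit
  obtain ⟨t, ht, htρ⟩ := hexit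
  have hdist : ContinuousOn (fun t => dist (Y t) (Z 0)) (Icc 0 T) :=
    (continuous_id.dist continuous_const).comp_continuousOn hY
  have hivt : ∀ t ∈ Icc 0 T, ρ ≤ dist (Y t) (Z 0) → ∃ r ∈ Icc 0 t, dist (Y r) (Z 0) = ρ :=
    fun t ht htρ => intermediate_value_Icc ht.1 (hdist.mono (Icc_subset_Icc_right ht.2))
      ⟨by simp [hY0, hρ.le], htρ⟩
  have hcompact : IsCompact (Icc 0 T ∩ (fun t => dist (Y t) (Z 0)) ⁻¹' {ρ}) :=
    isCompact_Icc.of_isClosed_subset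
      (hdist.preimage_isClosed_of_isClosed isClosed_Icc isClosed_singleton) inter_subset_left
  obtain ⟨r₀, hr₀, hr₀ρ⟩ := hivt t ht htρ
  obtain ⟨r, ⟨hr, hrρ⟩, hleast⟩ := hcompact.exists_isLeast ⟨r₀, ⟨hr₀.1, hr₀.2.trans ht.2⟩, hr₀ρ⟩
  have hYr : ∀ t ∈ Icc 0 r, Y t ∈ Metric.closedBall (Z 0) ρ := by
    intro t ht
    by_contra hlt
    rw [Metric.mem_closedBall, not_le] at hlt
    obtain ⟨r', hr', hr'ρ⟩ := hivt t ⟨ht.1, ht.2.trans hr.2⟩ hlt.le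
    have hle : r ≤ r' := hleast ⟨⟨hr'.1, hr'.2.trans (ht.2.trans hr.2)⟩, hr'ρ⟩
    have htr : t = r := le_antisymm ht.2 (hle.trans hr'.2)
    exact hlt.ne' (htr ▸ hrρ)
  obtain ⟨s, hs, hYs, -⟩ := key r hr hYr r (right_mem_Icc.2 hr.1)
  exact (hZρ s hs).ne (hYs ▸ hrρ)

/-- The regular trajectory, followed with clock `τ`, solves the singular equation. -/
lemma IsRegularTrajectory.exists_solution {d : ℕ} {V b : (Fin d → ℝ) → Fin d → ℝ}
    {q : (Fin d → ℝ) → ℝ} {S : Set (Fin d → ℝ)} {ε : ℝ} {Z : ℝ → Fin d → ℝ} {τ : ℝ → ℝ}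
    (hZ : IsRegularTrajectory V b q S ε Z τ) (h : IsRegularOn V b q S) {T : ℝ} (hT : 0 < T)
    (hTε : T < τ ε) :
    ∃ Y : ℝ → Fin d → ℝ, ContinuousOn Y (Icc 0 T) ∧ Y 0 = Z 0 ∧ (∀ t ∈ Ioc 0 T, 0 < q (Y t)) ∧
      IntegrableOn (fun t => b (Y t) + (q (Y t))⁻¹ • V (Y t)) (Ioc 0 T) ∧
      ∀ t ∈ Icc 0 T, Y t = Z 0 + ∫ r in (0 : ℝ)..t, (b (Y r) + (q (Y r))⁻¹ • V (Y r)) := by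
  have hmono := hZ.strictMonoOn_time
  obtain ⟨σ, hσc, hσ⟩ := exists_continuous_rightInverse_of_strictMonoOn hZ.pos.le
    hZ.continuousOn_time hmono
  rw [hZ.time_zero] at hσ
  have hT' : ∀ t ∈ Icc 0 T, t ∈ Icc 0 (τ ε) := fun t ht => ⟨ht.1, ht.2.trans hTε.le⟩
  have hmaps : ∀ t ∈ Icc 0 T, σ t ∈ Icc 0 ε := fun t ht => (hσ t (hT' t ht)).1
  have hτσ : ∀ t ∈ Icc 0 T, τ (σ t) = t := fun t ht => (hσ t (hT' t ht)).2
  have hmaps' : ∀ t ∈ Ioc 0 T, σ t ∈ Ioo 0 ε := fun t ht => by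
    have hσt := hmaps t (Ioc_subset_Icc_self ht)
    have hτt := hτσ t (Ioc_subset_Icc_self ht)
    refine ⟨hσt.1.lt_of_ne fun h0 => ?_, hσt.2.lt_of_ne fun hε => ?_⟩
    · rw [← h0, hZ.time_zero] at hτt
      exact ht.1.ne hτt
    · rw [hε] at hτt
      linarith [ht.2]
  have hσ0 : σ 0 = 0 := by
    have h0 : (0 : ℝ) ∈ Icc 0 T := left_mem_Icc.2 hT.le
    exact hmono.injOn (hmaps 0 h0) (left_mem_Icc.2 hZ.pos.le) (by rw [hτσ 0 h0, hZ.time_zero])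
  have hσ' : ∀ t ∈ Ioo 0 T, HasDerivAt σ (q (Z (σ t)))⁻¹ t := fun t ht => by
    have hσt := hmaps' t (Ioo_subset_Ioc_self ht)
    refine HasDerivAt.of_local_left_inverse hσc.continuousAt (hZ.hasDerivAt_time _ hσt)
      (hZ.q_pos _ (Ioo_subset_Ioc_self hσt)).ne' ?_
    filter_upwards [Ioo_mem_nhds ht.1 ht.2] with r hr using hτσ r (Ioo_subset_Icc_self hr)
  have hYc : ContinuousOn (Z ∘ σ) (Icc 0 T) := hZ.continuousOn.comp hσc.continuousOn hmaps
  have hYS : MapsTo (Z ∘ σ) (Icc 0 T) S := fun t ht => hZ.mem _ (hmaps t ht)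
  have hqY : ∀ t ∈ Ioc 0 T, 0 < q (Z (σ t)) := fun t ht =>
    hZ.q_pos _ (Ioo_subset_Ioc_self (hmaps' t ht))
  have hinv : IntegrableOn (fun t => (q (Z (σ t)))⁻¹) (Icc 0 T) := by
    rw [integrableOn_Icc_iff_integrableOn_Ioc]
    exact intervalIntegral.integrableOn_deriv_of_nonneg hσc.continuousOn hσ' fun t ht =>
      (inv_pos.2 (hqY t (Ioo_subset_Ioc_self ht))).le
  have hint : IntegrableOn (fun t => b (Z (σ t)) + (q (Z (σ t)))⁻¹ • V (Z (σ t))) (Ioc 0 T) :=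
    (((h.continuousOn_b.comp hYc hYS).integrableOn_compact isCompact_Icc).add
      (hinv.smul_continuousOn (h.continuousOn_V.comp hYc hYS) isCompact_Icc)).mono_set
        Ioc_subset_Icc_self
  refine ⟨Z ∘ σ, hYc, by simp [hσ0], hqY, hint, fun t ht => ?_⟩
  have hsub : Icc 0 t ⊆ Icc 0 T := Icc_subset_Icc_right ht.2
  have := intervalIntegral.integral_eq_sub_of_hasDerivAt_of_le (f := Z ∘ σ)
    (f' := fun t => b (Z (σ t)) + (q (Z (σ t)))⁻¹ • V (Z (σ t))) ht.1 (hYc.mono hsub)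
    (fun r hr => by
      have hr' : r ∈ Ioo 0 T := ⟨hr.1, hr.2.trans_le ht.2⟩
      refine ((hZ.hasDerivAt _ (hmaps' r (Ioo_subset_Ioc_self hr'))).scomp r
        (hσ' r hr')).congr_deriv ?_
      rw [smul_add, smul_smul, inv_mul_cancel₀ (hqY r (Ioo_subset_Ioc_self hr')).ne', one_smul])
    ((intervalIntegrable_iff_integrableOn_Ioc_of_le ht.1).2
      (hint.mono_set (Ioc_subset_Ioc_right ht.2)))
  simp only [Function.comp_apply, hσ0] at this ⊢
  rw [this, add_sub_cancel]

/-- A function vanishing at `0` with positive derivative there is positive just to the right. -/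
lemma HasDerivAt.eventually_pos_right {f : ℝ → ℝ} {f' : ℝ} (hf : HasDerivAt f f' 0)
    (hf0 : f 0 = 0) (hf' : 0 < f') : ∀ᶠ t in nhdsWithin 0 (Ioi 0), 0 < f t := by
  have h := (hasDerivAt_iff_tendsto_slope.1 hf).eventually (lt_mem_nhds hf')
  have hle : nhdsWithin (0 : ℝ) (Ioi 0) ≤ nhdsWithin 0 {0}ᶜ :=
    nhdsWithin_mono _ fun t (ht : 0 < t) => ht.ne'
  filter_upwards [h.filter_mono hle, self_mem_nhdsWithin] with t ht (ht0 : 0 < t)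
  rw [slope_def_field, hf0, sub_zero, sub_zero] at ht
  exact (div_pos_iff_of_pos_right ht0).1 ht

/-- Existence of a regular trajectory issued from a zero `y₀` of `q` at which `V` points strictly
into `{q > 0}`. -/
lemma exists_isRegularTrajectory {d : ℕ} {V b : (Fin d → ℝ) → Fin d → ℝ}
    {q : (Fin d → ℝ) → ℝ} {y₀ : Fin d → ℝ} (hV : ContDiffAt ℝ 1 V y₀) (hb : ContDiffAt ℝ 1 b y₀)
    (hq : ContDiffAt ℝ 1 q y₀) (hq0 : q y₀ = 0) (hpos : 0 < fderiv ℝ q y₀ (V y₀)) :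
    ∃ ρ > 0, IsRegularOn V b q (Metric.closedBall y₀ ρ) ∧ ∃ ε Z τ, Z 0 = y₀ ∧
      IsRegularTrajectory V b q (Metric.closedBall y₀ ρ) ε Z τ ∧
      ∀ s ∈ Icc 0 ε, dist (Z s) y₀ < ρ := by
  have hG : ContDiffAt ℝ 1 (fun y => q y • b y + V y) y₀ := (hq.smul hb).add hV
  have hV0 : 0 < ‖V y₀‖ := norm_pos_iff.2 fun h0 => by simp [h0] at hpos
  obtain ⟨L, S, hS, hL⟩ := hG.exists_lipschitzOnWith
  have hnhds : ∀ᶠ y in nhds y₀, y ∈ S ∧ ContinuousAt V y ∧ ContinuousAt b y ∧ ContinuousAt q y ∧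
      ‖V y₀‖ / 2 < ‖V y‖ := by
    filter_upwards [hS, hV.eventually (by simp), hb.eventually (by simp), hq.eventually (by simp),
      hV.continuousAt.norm.eventually (lt_mem_nhds (half_lt_self hV0))] with y h₁ h₂ h₃ h₄ h₅
    exact ⟨h₁, h₂.continuousAt, h₃.continuousAt, h₄.continuousAt, h₅⟩
  obtain ⟨ρ, hρ, hball⟩ := Metric.nhds_basis_closedBall.mem_iff.1 hnhds
  have hreg : IsRegularOn V b q (Metric.closedBall y₀ ρ) :=
    { continuousOn_V := fun y hy => (hball hy).2.1.continuousWithinAt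
      continuousOn_b := fun y hy => (hball hy).2.2.1.continuousWithinAt
      continuousOn_q := fun y hy => (hball hy).2.2.2.1.continuousWithinAt
      norm_V_ge := ⟨_, half_pos hV0, fun y hy => (hball hy).2.2.2.2.le⟩
      lipschitz := ⟨L, hL.mono fun y hy => (hball hy).1⟩ }
  refine ⟨ρ, hρ, hreg, ?_⟩
  obtain ⟨Z, hZ0, δ, hδ, hZ⟩ :=
    hG.exists_forall_mem_closedBall_exists_eq_forall_mem_Ioo_hasDerivAt₀ 0
  rw [zero_sub, zero_add] at hZ
  have hZ0' := hZ 0 ⟨neg_lt_zero.2 hδ, hδ⟩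
  have hqZ : HasDerivAt (q ∘ Z) (fderiv ℝ q y₀ (V y₀)) 0 := by
    have hq' : HasFDerivAt q (fderiv ℝ q y₀) (Z 0) := by
      rw [hZ0]
      exact (hq.differentiableAt one_ne_zero).hasFDerivAt
    refine (hq'.comp_hasDerivAt 0 hZ0').congr_deriv ?_
    rw [hZ0, hq0, zero_smul, zero_add]
  have hev : ∀ᶠ s in nhdsWithin (0 : ℝ) (Ioi 0), s < δ ∧ 0 < q (Z s) ∧ dist (Z s) y₀ < ρ := by
    have h₁ : ∀ᶠ s in nhds (0 : ℝ), dist (Z s) y₀ < ρ :=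
      hZ0'.continuousAt.eventually (by rw [hZ0]; exact Metric.ball_mem_nhds y₀ hρ)
    filter_upwards [nhdsWithin_le_nhds (gt_mem_nhds hδ), nhdsWithin_le_nhds h₁,
      hqZ.eventually_pos_right (by simp [hZ0, hq0]) hpos] with s h₁ h₂ h₃ using ⟨h₁, h₃, h₂⟩
  obtain ⟨ε, hε, hsub⟩ := mem_nhdsGT_iff_exists_Ioc_subset.1 hev
  rw [mem_Ioi] at hε
  have hZρ : ∀ s ∈ Icc 0 ε, dist (Z s) y₀ < ρ := fun s hs => by
    rcases hs.1.eq_or_lt with rfl | h0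
    · simpa [hZ0] using hρ
    · exact (hsub ⟨h0, hs.2⟩).2.2
  have hεδ : ε < δ := (hsub ⟨hε, le_rfl⟩).1
  have hZd : ∀ s ∈ Icc 0 ε, HasDerivAt Z (q (Z s) • b (Z s) + V (Z s)) s := fun s hs =>
    hZ s ⟨by linarith [hs.1], hs.2.trans_lt hεδ⟩
  have hZc : ContinuousOn Z (Icc 0 ε) := fun s hs => (hZd s hs).continuousAt.continuousWithinAt
  have hqZc : ContinuousOn (fun s => q (Z s)) (Icc 0 ε) :=
    hreg.continuousOn_q.comp hZc fun s hs => (hZρ s hs).le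
  obtain ⟨hτ, hτ'⟩ := continuousOn_and_hasDerivAt_primitive hε.le
    (hqZc.mono Ioo_subset_Icc_self)
    ((hqZc.integrableOn_compact isCompact_Icc).mono_set Ioc_subset_Icc_self)
  exact ⟨ε, Z, _, hZ0,
    { pos := hε
      continuousOn := hZc
      hasDerivAt := fun s hs => hZd s (Ioo_subset_Icc_self hs)
      mem := fun s hs => (hZρ s hs).le
      q_pos := fun s hs => (hsub hs).2.1
      continuousOn_time := hτ
      hasDerivAt_time := hτ'
      time_zero := by simp }, hZρ⟩

/-- Existence and uniqueness for the singular transition-path ODE started on the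
boundary: for all sufficiently small `T > 0` there is exactly one continuous
`Ȳ : [0,T] → ℝ^d` with `Ȳ(0) = y₀`, `q(Ȳ(t)) > 0` on `(0,T]`, `K ∘ Ȳ` integrable,
and `Ȳ(t) = y₀ + ∫₀ᵗ K(Ȳ(s)) ds`. -/
theorem singular_ode_exists_unique {d : ℕ} (hd : 1 ≤ d)
    (a : (Fin d → ℝ) → Fin d → Fin d → ℝ)
    (ha : ContDiff ℝ 1 a) (ha_symm : ∀ x i j, a x i j = a x j i)
    (ha_pos : ∀ x (ξ : Fin d → ℝ), ξ ≠ 0 → 0 < ∑ i, ∑ j, ξ i * a x i j * ξ j)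
    (b : (Fin d → ℝ) → Fin d → ℝ) (hb : ContDiff ℝ 1 b)
    (q : (Fin d → ℝ) → ℝ) (y₀ : Fin d → ℝ)
    (U : Set (Fin d → ℝ)) (hU : IsOpen U) (hy₀U : y₀ ∈ U)
    (hq : ContDiffOn ℝ 2 q U)
    (hq0 : q y₀ = 0)
    (hhopf : 0 < ∑ i, ∑ j, pd i q y₀ * a y₀ i j * pd j q y₀) :
    ∃ T₀ > (0 : ℝ), ∀ T : ℝ, 0 < T → T ≤ T₀ →
      (∃ Y : ℝ → Fin d → ℝ, IsTPSolution a b q y₀ T Y) ∧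
      ∀ Y₁ Y₂ : ℝ → Fin d → ℝ, IsTPSolution a b q y₀ T Y₁ →
        IsTPSolution a b q y₀ T Y₂ → Set.EqOn Y₁ Y₂ (Set.Icc 0 T) := by
  set V : (Fin d → ℝ) → Fin d → ℝ := fun y i => 2 * ∑ j, a y i j * pd j q y with hV_def
  have hK : ∀ y, Kdrift a b q y = b y + (q y)⁻¹ • V y := fun y => by
    funext i
    simp only [Kdrift, hV_def, Pi.add_apply, Pi.smul_apply, smul_eq_mul]
    ring
  have hq2 : ContDiffAt ℝ 2 q y₀ := hq.contDiffAt (hU.mem_nhds hy₀U)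
  have hV : ContDiffAt ℝ 1 V y₀ := by
    refine contDiffAt_pi.2 fun i => contDiffAt_const.mul (ContDiffAt.sum fun j _ => ?_)
    have haij : ContDiffAt ℝ 1 (fun y => a y i j) y₀ :=
      contDiffAt_pi.1 (contDiffAt_pi.1 ha.contDiffAt i) j
    exact haij.mul ((hq2.fderiv_right (by norm_num)).clm_apply contDiffAt_const)
  have hpos : 0 < fderiv ℝ q y₀ (V y₀) := by
    have hsum : fderiv ℝ q y₀ (V y₀) = ∑ i, V y₀ i * pd i q y₀ := by
      conv_lhs => rw [pi_eq_sum_univ' (V y₀)]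
      simp [pd]
    have htwo : fderiv ℝ q y₀ (V y₀) = 2 * ∑ i, ∑ j, pd i q y₀ * a y₀ i j * pd j q y₀ := by
      rw [hsum, Finset.mul_sum]
      refine Finset.sum_congr rfl fun i _ => ?_
      simp only [hV_def, Finset.mul_sum, Finset.sum_mul]
      exact Finset.sum_congr rfl fun j _ => by ring
    rw [htwo]
    positivity
  obtain ⟨ρ, hρ, hreg, ε, Z, τ, rfl, hZ, hZρ⟩ := exists_isRegularTrajectory hV hb.contDiffAt
    (hq2.of_le (by norm_num)) hq0 hpos
  have hτε : 0 < τ ε := by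
    rw [← hZ.time_zero]
    exact hZ.strictMonoOn_time (left_mem_Icc.2 hZ.pos.le) (right_mem_Icc.2 hZ.pos.le) hZ.pos
  simp only [IsTPSolution, hK]
  refine ⟨τ ε / 2, half_pos hτε, fun T hT hTle => ?_⟩
  have hTε : T < τ ε := hTle.trans_lt (half_lt_self hτε)
  refine ⟨hZ.exists_solution hreg hT hTε, ?_⟩
  rintro Y₁ Y₂ ⟨hc₁, h0₁, hq₁, hi₁, he₁⟩ ⟨hc₂, h0₂, hq₂, hi₂, he₂⟩ t ht
  obtain ⟨s₁, hs₁, hY₁, hτ₁⟩ := hZ.exists_eq hρ hreg hZρ hTε hc₁ h0₁ hq₁ hi₁ he₁ t ht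
  obtain ⟨s₂, hs₂, hY₂, hτ₂⟩ := hZ.exists_eq hρ hreg hZρ hTε hc₂ h0₂ hq₂ hi₂ he₂ t ht
  rw [hY₁, hY₂, hZ.strictMonoOn_time.injOn hs₁ hs₂ (hτ₁.trans hτ₂.symm)]
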